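/- Let B be a Bernoulli random variable with P(B=1) = p ∈ (0,1), let X and Z be two i.i.d. standard Gaussian random variables, with B, X, Z mutually independent, let ρ, τ ∈ (−1,1) with ρ ≠ τ, and define Y = B(ρX + √(1−ρ²)Z) + (1−B)(τX + √(1−τ²)Z). Then for every z ∈ ℝ, lim_{x→∞} P(Y − ρx ≤ √(1−ρ²)·z | X > x) = p·Φ(z) + (1−p)·𝟙{τ < ρ}; in particular the limiting conditional distribution is degenerate, with positive mass at −∞ (if τ > ρ) or at +∞ (if τ < ρ). -/

import Mathlib

open MeasureTheory ProbabilityTheory Filter Set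

/-- The standard normal cumulative distribution function `Φ`. -/
noncomputable def stdNormalCDF (y : ℝ) : ℝ :=
  ∫ s in Set.Iic y, Real.exp (-s ^ 2 / 2) / Real.sqrt (2 * Real.pi)

lemma aux_cdf_eq (t : ℝ) : cdf (gaussianReal 0 1) t = stdNormalCDF t := by
  rw [cdf_eq_real, Measure.real, gaussianReal_apply_eq_integral 0 one_ne_zero,
    ENNReal.toReal_ofReal (integral_nonneg (fun x => gaussianPDFReal_nonneg _ _ _)), stdNormalCDF]
  congr 1
  ext s
  simp [gaussianPDFReal]
  ring

lemma aux_cdf_cont : Continuous (fun t => cdf (gaussianReal 0 1) t) := by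
  have hint := integrable_gaussianPDFReal 0 1
  have h : (fun t => cdf (gaussianReal 0 1) t) = fun t => (∫ x in Set.Iic (0:ℝ), gaussianPDFReal 0 1 x) +
      ∫ x in (0:ℝ)..t, gaussianPDFReal 0 1 x := by
    ext t
    rw [cdf_eq_real, Measure.real, gaussianReal_apply_eq_integral 0 one_ne_zero,
      ENNReal.toReal_ofReal (integral_nonneg (fun x => gaussianPDFReal_nonneg _ _ _)),
      ← intervalIntegral.integral_Iic_sub_Iic hint.integrableOn hint.integrableOn]
    ring
  rw [h]
  exact continuous_const.add
    (intervalIntegral.continuous_primitive (fun a b => hint.intervalIntegrable) 0)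

lemma aux_tail_pos (x : ℝ) : 0 < (gaussianReal 0 1).real (Set.Ioi x) := by
  rw [Measure.real, ENNReal.toReal_pos_iff]
  refine ⟨pos_iff_ne_zero.2 fun h => ?_, measure_lt_top _ _⟩
  have := gaussianReal_absolutelyContinuous' 0 one_ne_zero h
  simp at this

lemma aux_tail (x δ : ℝ) (hδ : 0 ≤ δ) :
    (gaussianReal 0 1).real (Set.Ioi (x + δ)) ≤ Real.exp (-(x * δ)) * (gaussianReal 0 1).real (Set.Ioi x) := by
  have h1 : (gaussianReal 0 1) (Set.Ioi (x + δ)) = gaussianReal (-δ) 1 (Set.Ioi x) := by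
    have := gaussianReal_map_add_const (μ := 0) (v := 1) (-δ)
    rw [zero_add] at this
    rw [← this, Measure.map_apply (by fun_prop) measurableSet_Ioi]
    congr 1
    ext t
    simp [← sub_eq_add_neg]
  rw [Measure.real, Measure.real, h1, gaussianReal_apply_eq_integral _ one_ne_zero,
    gaussianReal_apply_eq_integral _ one_ne_zero,
    ENNReal.toReal_ofReal (integral_nonneg (fun x => gaussianPDFReal_nonneg _ _ _)),
    ENNReal.toReal_ofReal (integral_nonneg (fun x => gaussianPDFReal_nonneg _ _ _)),
    ← integral_const_mul]
  refine setIntegral_mono_on (integrable_gaussianPDFReal _ _).integrableOn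
    ((integrable_gaussianPDFReal _ _).const_mul _).integrableOn measurableSet_Ioi ?_
  intro t ht
  have ht : x < t := ht
  simp only [gaussianPDFReal]
  rw [mul_left_comm, ← Real.exp_add]
  gcongr
  push_cast
  nlinarith [mul_le_mul_of_nonneg_right ht.le hδ, sq_nonneg δ]

lemma aux_comp {Ω : Type*} [MeasurableSpace Ω] (P : Measure Ω) [IsProbabilityMeasure P]
    (X Z : Ω → ℝ) (A : Set Ω) (q : ℝ)
    (hA : ∀ t x, P.real (A ∩ {ω | Z ω ≤ t} ∩ {ω | X ω > x}) =
      q * cdf (gaussianReal 0 1) t * (gaussianReal 0 1).real (Set.Ioi x))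
    (hXt : ∀ x, P.real {ω | X ω > x} = (gaussianReal 0 1).real (Set.Ioi x))
    (a s ρ w L : ℝ) (ha : |a| ≤ 1) (hs : 0 < s)
    (hL1 : Tendsto (fun x => cdf (gaussianReal 0 1) ((w + (ρ - a) * x + 1 / √x) / s)) atTop (nhds L))
    (hL2 : Tendsto (fun x => cdf (gaussianReal 0 1) ((w + (ρ - a) * x - 1 / √x) / s)) atTop (nhds L)) :
    Tendsto (fun x => P.real (A ∩ {ω | a * X ω + s * Z ω - ρ * x ≤ w ∧ X ω > x}) /
      P.real {ω | X ω > x}) atTop (nhds (q * L)) := by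
  have he : Tendsto (fun x : ℝ => Real.exp (-√x)) atTop (nhds 0) :=
    Real.tendsto_exp_neg_atTop_nhds_zero.comp Real.tendsto_sqrt_atTop
  have hup := (hL1.const_mul q).add he
  have hlo := (hL2.const_mul q).sub he
  rw [add_zero] at hup
  rw [sub_zero] at hlo
  have key : ∀ x : ℝ, 0 < x →
      (gaussianReal 0 1).real (Set.Ioi (x + 1 / √x)) ≤ Real.exp (-√x) * (gaussianReal 0 1).real (Set.Ioi x) := by
    intro x hx
    have := aux_tail x (1 / √x) (by positivity)
    rwa [mul_one_div, Real.div_sqrt] at this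
  have hb : ∀ x : ℝ, 0 < x → ∀ ω, X ω > x → ¬ X ω > x + 1 / √x →
      |a * (X ω - x)| ≤ 1 / √x := by
    intro x hx ω h1 h2
    rw [abs_mul, abs_of_pos (sub_pos.2 h1)]
    have : X ω - x ≤ 1 / √x := by linarith
    nlinarith [abs_nonneg a]
  refine tendsto_of_tendsto_of_tendsto_of_le_of_le' hlo hup ?_ ?_
  · filter_upwards [eventually_gt_atTop 0] with x hx
    rw [hXt, le_div_iff₀ (aux_tail_pos x), sub_mul, ← hA]
    have hsub : A ∩ {ω | Z ω ≤ (w + (ρ - a) * x - 1 / √x) / s} ∩ {ω | X ω > x} ⊆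
        (A ∩ {ω | a * X ω + s * Z ω - ρ * x ≤ w ∧ X ω > x}) ∪ {ω | X ω > x + 1 / √x} := by
      rintro ω ⟨⟨h1, h2⟩, h3⟩
      by_cases h4 : X ω > x + 1 / √x
      · exact Or.inr h4
      · refine Or.inl ⟨h1, ?_, h3⟩
        have h5 := hb x hx ω h3 h4
        have h2' : Z ω ≤ (w + (ρ - a) * x - 1 / √x) / s := h2
        rw [le_div_iff₀ hs] at h2'
        have := le_abs_self (a * (X ω - x))
        linarith
    have h6 := (measureReal_mono (μ := P) hsub).trans (measureReal_union_le _ _)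
    rw [hXt] at h6
    linarith [key x hx]
  · filter_upwards [eventually_gt_atTop 0] with x hx
    rw [hXt, div_le_iff₀ (aux_tail_pos x), add_mul, ← hA]
    have hsub : (A ∩ {ω | a * X ω + s * Z ω - ρ * x ≤ w ∧ X ω > x}) ⊆
        A ∩ {ω | Z ω ≤ (w + (ρ - a) * x + 1 / √x) / s} ∩ {ω | X ω > x} ∪
          {ω | X ω > x + 1 / √x} := by
      rintro ω ⟨h1, h2, h3⟩
      by_cases h4 : X ω > x + 1 / √x
      · exact Or.inr h4
      · refine Or.inl ⟨⟨h1, ?_⟩, h3⟩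
        have h5 := hb x hx ω h3 h4
        change Z ω ≤ _
        rw [le_div_iff₀ hs]
        have := neg_abs_le (a * (X ω - x))
        linarith
    have h6 := (measureReal_mono (μ := P) hsub).trans (measureReal_union_le _ _)
    rw [hXt] at h6
    linarith [key x hx]

/-- Example 2 (mixture of two bivariate Gaussian vectors): the limiting conditional
distribution is degenerate, with a positive mass either at `-∞` or at `+∞`. -/
theorem gaussian_mixture_degenerate_limit {Ω : Type*} [MeasurableSpace Ω] (P : Measure Ω)
    [IsProbabilityMeasure P]
    (B X Z : Ω → ℝ) (hB : Measurable B) (hX : Measurable X) (hZ : Measurable Z)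
    -- `B`, `X`, `Z` are mutually independent:
    (hindep : iIndepFun (m := fun _ : Fin 3 => (inferInstance : MeasurableSpace ℝ)) ![B, X, Z] P)
    -- `B` is Bernoulli with `P(B = 1) = p ∈ (0,1)`:
    (p : ℝ) (hp : p ∈ Set.Ioo (0 : ℝ) 1)
    (hBval : ∀ᵐ ω ∂P, B ω = 0 ∨ B ω = 1)
    (hBp : (P {ω | B ω = 1}).toReal = p)
    -- `X` and `Z` are standard Gaussian:
    (hXlaw : Measure.map X P = gaussianReal 0 1)
    (hZlaw : Measure.map Z P = gaussianReal 0 1)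
    (ρ τ : ℝ) (hρ : ρ ∈ Set.Ioo (-1 : ℝ) 1) (hτ : τ ∈ Set.Ioo (-1 : ℝ) 1) (hρτ : ρ ≠ τ)
    (Y : Ω → ℝ)
    (hY : Y = fun ω => B ω * (ρ * X ω + Real.sqrt (1 - ρ ^ 2) * Z ω) +
      (1 - B ω) * (τ * X ω + Real.sqrt (1 - τ ^ 2) * Z ω)) :
    ∀ z : ℝ,
      Tendsto (fun x =>
          (P {ω | Y ω - ρ * x ≤ Real.sqrt (1 - ρ ^ 2) * z ∧ X ω > x}).toReal /
            (P {ω | X ω > x}).toReal)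
        atTop (nhds (p * stdNormalCDF z + (1 - p) * (if τ < ρ then 1 else 0))) := by
  intro z
  have hXt : ∀ x, P.real {ω | X ω > x} = (gaussianReal 0 1).real (Set.Ioi x) := by
    intro x
    rw [← hXlaw, map_measureReal_apply hX measurableSet_Ioi]
    rfl
  have hZt : ∀ t, P.real {ω | Z ω ≤ t} = cdf (gaussianReal 0 1) t := by
    intro x
    rw [cdf_eq_real, ← hZlaw, map_measureReal_apply hZ measurableSet_Iic]
    rfl
  have hA : ∀ b t x, P.real ({ω | B ω = b} ∩ {ω | Z ω ≤ t} ∩ {ω | X ω > x}) =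
      P.real {ω | B ω = b} * cdf (gaussianReal 0 1) t * (gaussianReal 0 1).real (Set.Ioi x) := by
    intro b t x
    have h := hindep.measure_inter_preimage_eq_mul Finset.univ
      (sets := ![{b}, Set.Ioi x, Set.Iic t]) (by
        intro i _
        fin_cases i
        · exact measurableSet_singleton b
        · exact measurableSet_Ioi
        · exact measurableSet_Iic)
    rw [Fin.prod_univ_three] at h
    have hset : (⋂ i ∈ (Finset.univ : Finset (Fin 3)),
        (![B, X, Z] i) ⁻¹' (![{b}, Set.Ioi x, Set.Iic t] i)) =
        {ω | B ω = b} ∩ {ω | Z ω ≤ t} ∩ {ω | X ω > x} := by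
      ext ω
      simp [Fin.forall_fin_succ]
      tauto
    rw [hset] at h
    have h' : P ({ω | B ω = b} ∩ {ω | Z ω ≤ t} ∩ {ω | X ω > x}) =
      P {ω | B ω = b} * P {ω | X ω > x} * P {ω | Z ω ≤ t} := h
    rw [← hZt, ← hXt, Measure.real, h', ENNReal.toReal_mul, ENNReal.toReal_mul]
    simp only [Measure.real]
    ring
  have hm1 : MeasurableSet {ω | B ω = 1} := hB (measurableSet_singleton 1)
  have hB0 : P.real {ω | B ω = 0} = 1 - p := by
    rw [← hBp]
    change _ = 1 - P.real _
    rw [← probReal_compl_eq_one_sub hm1]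
    apply measureReal_congr
    filter_upwards [hBval] with ω h
    apply propext
    change B ω = 0 ↔ ¬ (B ω = 1)
    rcases h with h | h <;> simp [h]
  have hinv : Tendsto (fun x : ℝ => 1 / √x) atTop (nhds 0) := by
    simp only [one_div]
    exact Real.tendsto_sqrt_atTop.inv_tendsto_atTop
  have hσ : ∀ a ∈ Set.Ioo (-1 : ℝ) 1, 0 < √(1 - a ^ 2) := by
    intro a ha
    apply Real.sqrt_pos.2
    nlinarith [ha.1, ha.2]
  have habs : ∀ a ∈ Set.Ioo (-1 : ℝ) 1, |a| ≤ 1 := fun a ha => abs_le.2 ⟨ha.1.le, ha.2.le⟩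
  have hs := hσ ρ hρ
  have hs' := hσ τ hτ
  have T1 := aux_comp P X Z {ω | B ω = 1} _ (hA 1) hXt ρ (√(1 - ρ ^ 2)) ρ (√(1 - ρ ^ 2) * z)
    (cdf (gaussianReal 0 1) z) (habs ρ hρ) hs
    (by
      refine (aux_cdf_cont.tendsto z).comp ?_
      have : Tendsto (fun x : ℝ => (√(1 - ρ ^ 2) * z + (ρ - ρ) * x + 1 / √x) / √(1 - ρ ^ 2)) atTop
        (nhds ((√(1 - ρ ^ 2) * z + 0) / √(1 - ρ ^ 2))) := by
        refine Tendsto.div_const (Tendsto.add ?_ hinv) _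
        simp
      rwa [add_zero, mul_div_cancel_left₀ _ hs.ne'] at this)
    (by
      refine (aux_cdf_cont.tendsto z).comp ?_
      have : Tendsto (fun x : ℝ => (√(1 - ρ ^ 2) * z + (ρ - ρ) * x - 1 / √x) / √(1 - ρ ^ 2)) atTop
        (nhds ((√(1 - ρ ^ 2) * z - 0) / √(1 - ρ ^ 2))) := by
        refine Tendsto.div_const (Tendsto.sub ?_ hinv) _
        simp
      rwa [sub_zero, mul_div_cancel_left₀ _ hs.ne'] at this)
  have hcases : ∀ g : ℝ → ℝ, Tendsto g atTop (nhds 0) →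
      Tendsto (fun x => cdf (gaussianReal 0 1) ((√(1 - ρ ^ 2) * z + (ρ - τ) * x + g x) / √(1 - τ ^ 2))) atTop
        (nhds (if τ < ρ then 1 else 0)) := by
    intro g hg
    split_ifs with h
    · refine (tendsto_cdf_atTop _).comp ?_
      refine Tendsto.atTop_div_const hs' (Tendsto.atTop_add ?_ hg)
      exact tendsto_atTop_add_const_left _ _ (tendsto_id.const_mul_atTop (sub_pos.2 h))
    · have h : ρ - τ < 0 := sub_neg.2 (lt_of_le_of_ne (not_lt.1 h) hρτ)
      refine (tendsto_cdf_atBot _).comp ?_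
      refine Tendsto.atBot_div_const hs' (Tendsto.atBot_add ?_ hg)
      exact tendsto_atBot_add_const_left _ _ (tendsto_id.const_mul_atTop_of_neg h)
  have T0 := aux_comp P X Z {ω | B ω = 0} _ (hA 0) hXt τ (√(1 - τ ^ 2)) ρ (√(1 - ρ ^ 2) * z)
    (if τ < ρ then 1 else 0) (habs τ hτ) hs' (hcases _ hinv)
    (by simpa [sub_eq_add_neg] using hcases (fun x => -(1 / √x)) (by simpa using hinv.neg))
  have T := T1.add T0
  rw [hB0, aux_cdf_eq, show P.real {ω | B ω = 1} = p from hBp] at T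
  refine T.congr fun x => ?_
  rw [← add_div]
  congr 1
  change _ = P.real _
  rw [← measureReal_inter_add_sdiff (μ := P)
    (s := {ω | Y ω - ρ * x ≤ √(1 - ρ ^ 2) * z ∧ X ω > x}) hm1]
  congr 1
  · congr 1
    ext ω
    simp only [Set.mem_inter_iff, Set.mem_setOf_eq, hY]
    constructor
    · rintro ⟨h1, h2⟩
      rw [h1]
      simpa using h2
    · rintro ⟨h2, h1⟩
      rw [h1] at h2
      simpa [h1] using h2
  · apply measureReal_congr
    filter_upwards [hBval] with ω h
    apply propext
    change (B ω = 0 ∧ (_ ≤ _ ∧ _ > _)) ↔ ((Y ω - _ ≤ _ ∧ _ > _) ∧ ¬ (B ω = 1))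
    rw [hY]
    rcases h with h | h <;> simp [h]
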